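/- arXiv:0802.3189 — 2 statements merged into one kernel-verified Lean document; each statement's English description precedes it below -/
import Mathlib

section
/- Let f be a holomorphic function on U with ∫_U |f|² |z_1|^{-2α} dV < ∞, where U ⊆ ℂⁿ is a connected open neighborhood of a point of the hyperplane {z_1 = 0}, α ≥ 1 is a real number, and dV is Lebesgue measure. Then f is divisible by z_1^{⌊α⌋}, i.e. f = z_1^{⌊α⌋} · g for some holomorphic g on U. -/
open MeasureTheory


lemma paramInt {n : ℕ} (H : (Fin n → ℂ) → ℝ → ℂ) (q : Fin n → ℂ) (R M a b : ℝ) (hR : 0 < R)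
    (hd : ∀ t, DifferentiableOn ℂ (fun z => H z t) (Metric.ball q R))
    (hb : ∀ t, ∀ z ∈ Metric.ball q R, ‖H z t‖ ≤ M)
    (hc : ∀ z ∈ Metric.ball q R, Continuous (H z)) :
    DifferentiableAt ℂ (fun z => ∫ t in a..b, H z t) q := by
  have hda : ∀ t, ∀ z ∈ Metric.ball q R, DifferentiableAt ℂ (fun z => H z t) z := fun t z hz =>
    (hd t).differentiableAt (Metric.isOpen_ball.mem_nhds hz)
  have hq : q ∈ Metric.ball q R := Metric.mem_ball_self hR
  have key := intervalIntegral.hasFDerivAt_integral_of_dominated_of_fderiv_le (𝕜 := ℂ)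
    (μ := volume) (a := a) (b := b)
    (F := H) (F' := fun z t => fderiv ℂ (fun z => H z t) z) (x₀ := q)
    (s := Metric.ball q (R/2)) (bound := fun _ => (M + M) / (R/2))
    (Metric.ball_mem_nhds q (by positivity)) ?_ ?_ ?_ ?_ ?_ ?_
  · exact key.differentiableAt
  · filter_upwards [Metric.ball_mem_nhds q hR] with z hz
    exact (hc z hz).aestronglyMeasurable
  · exact (hc q hq).intervalIntegrable _ _
  · have h1 : ∀ i : Fin n, AEStronglyMeasurable
        (fun t => fderiv ℂ (fun z => H z t) q (Pi.single i 1)) (volume.restrict (Set.uIoc a b)) := by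
      intro i
      set v : Fin n → ℂ := Pi.single i 1
      have hlim : Filter.Tendsto (fun k : ℕ => ((R/2 / ((k:ℝ)+1) : ℝ) : ℂ)) Filter.atTop (nhdsWithin 0 {0}ᶜ) := by
        rw [tendsto_nhdsWithin_iff]
        constructor
        · have : Filter.Tendsto (fun k : ℕ => (R/2 / ((k:ℝ)+1) : ℝ)) Filter.atTop (nhds 0) := by
            have := (tendsto_one_div_add_atTop_nhds_zero_nat (𝕜 := ℝ)).const_mul (R/2)
            simpa [div_eq_mul_inv] using this
          exact_mod_cast (Complex.continuous_ofReal.tendsto 0).comp this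
        · refine Filter.Eventually.of_forall fun k => ?_
          have : (R/2 / ((k:ℝ)+1) : ℝ) ≠ 0 := by positivity
          simpa using (Complex.ofReal_ne_zero.2 this)
      refine aestronglyMeasurable_of_tendsto_ae Filter.atTop
        (f := fun (k : ℕ) t => ((R/2 / ((k:ℝ)+1) : ℝ) : ℂ)⁻¹ •
          (H (q + ((R/2 / ((k:ℝ)+1) : ℝ) : ℂ) • v) t - H q t)) ?_ ?_
      · intro k
        have hm : q + ((R/2 / ((k:ℝ)+1) : ℝ) : ℂ) • v ∈ Metric.ball q R := by
          rw [Metric.mem_ball, dist_self_add_left, norm_smul]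
          have hv : ‖v‖ = 1 := by simp [v, Pi.norm_single]
          rw [hv, mul_one, Complex.norm_real, Real.norm_of_nonneg (by positivity)]
          calc R/2 / ((k:ℝ)+1) ≤ R/2 := div_le_self (by positivity) (by simp)
            _ < R := by linarith
        have hcont2 : Continuous fun t => ((R/2 / ((k:ℝ)+1) : ℝ) : ℂ)⁻¹ •
          (H (q + ((R/2 / ((k:ℝ)+1) : ℝ) : ℂ) • v) t - H q t) := by
            have h5 := hc _ hm
            have h6 := hc q hq
            fun_prop
        exact hcont2.aestronglyMeasurable
      · refine Filter.Eventually.of_forall fun t => ?_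
        have h2 := (hda t q hq).hasFDerivAt.hasLineDerivAt v
        have h3 := (hasDerivAt_iff_tendsto_slope_zero.1 h2).comp hlim
        simpa [Function.comp_def] using h3
    have h2 : (fun t => fderiv ℂ (fun z => H z t) q) = fun t => ∑ i : Fin n,
        (fderiv ℂ (fun z => H z t) q (Pi.single i 1)) • (ContinuousLinearMap.proj i : (Fin n → ℂ) →L[ℂ] ℂ) := by
      funext t
      ext x
      have := (fderiv ℂ (fun z => H z t) q).toLinearMap.pi_apply_eq_sum_univ x
      simp only [ContinuousLinearMap.coe_coe] at this
      rw [this]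
      have e : ∀ i : Fin n, (fun j => if i = j then (1 : ℂ) else 0) = Pi.single i 1 := by
        intro i
        funext j
        simp [Pi.single_apply, eq_comm]
      simp [mul_comm, e]
    rw [h2]
    refine Finset.aestronglyMeasurable_fun_sum _ fun i _ => ?_
    exact (h1 i).smul_const _
  · refine Filter.Eventually.of_forall fun t _ z hz => ?_
    have hsub : Metric.ball z (R/2) ⊆ Metric.ball q R :=
      Metric.ball_subset_ball' (by have := Metric.mem_ball.1 hz; linarith)
    refine Complex.norm_fderiv_le_div_of_mapsTo_ball ((hd t).mono hsub) ?_ (by positivity)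
    intro y hy
    rw [Metric.mem_closedBall, dist_eq_norm]
    exact (norm_sub_le _ _).trans (add_le_add (hb t _ (hsub hy))
      (hb t _ (hsub (Metric.mem_ball_self (by positivity)))))
  · exact intervalIntegrable_const
  · refine Filter.Eventually.of_forall fun t _ z hz => (hda t z ?_).hasFDerivAt
    exact Metric.ball_subset_ball (by linarith) hz

lemma vanish {n : ℕ} (i0 : Fin n) (U : Set (Fin n → ℂ)) (hU : IsOpen U) (q : Fin n → ℂ)
    (hq : q ∈ U) (hq0 : q i0 = 0) (α : ℝ) (hα : 1 ≤ α) (f : (Fin n → ℂ) → ℂ)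
    (hf : ContinuousAt f q)
    (hint : (∫⁻ z in U ∩ {z | z i0 ≠ 0}, ENNReal.ofReal (‖f z‖ ^ 2 * ‖z i0‖ ^ (-(2 * α)))) ≠ ⊤) :
    f q = 0 := by
  by_contra hne
  set c := ‖f q‖ / 2 with hc
  have hfq : 0 < ‖f q‖ := norm_pos_iff.2 hne
  have hcpos : 0 < c := by positivity
  have h1 : ∀ᶠ z in nhds q, z ∈ U ∧ c < ‖f z‖ :=
    Filter.Eventually.and (hU.mem_nhds hq) (hf.norm.eventually (lt_mem_nhds (by linarith)))
  obtain ⟨R, hR, hball⟩ := Metric.eventually_nhds_iff_ball.1 h1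
  set r := min R 1 with hr
  have hrpos : 0 < r := by positivity
  have hr1 : r ≤ 1 := min_le_right _ _
  have hrR : r ≤ R := min_le_left _ _
  set ρ : ℕ → ℝ := fun k => r / ((k:ℝ)+1) with hρ
  have hρpos : ∀ k, 0 < ρ k := fun k => by positivity
  have hρr : ∀ k, ρ k ≤ r := fun k => div_le_self hrpos.le (by simp)
  set A : ℕ → Set (Fin n → ℂ) := fun k => Set.pi Set.univ
    (fun i => if i = i0 then Metric.ball 0 (ρ k) \ {0} else Metric.ball (q i) r) with hA
  have hAmem : ∀ k, ∀ z ∈ A k, z i0 ≠ 0 ∧ ‖z i0‖ < ρ k ∧ z ∈ Metric.ball q R := by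
    intro k z hz
    have h0 := hz i0 (Set.mem_univ _)
    simp only [if_true, Set.mem_sdiff, Metric.mem_ball, dist_zero_right,
      Set.mem_singleton_iff] at h0
    refine ⟨h0.2, h0.1, ?_⟩
    refine Metric.ball_subset_ball hrR ?_
    rw [Metric.mem_ball, dist_pi_lt_iff hrpos]
    intro i
    by_cases hi : i = i0
    · subst hi
      rw [hq0, dist_zero_right]
      exact h0.1.trans_le (hρr k)
    · have := hz i (Set.mem_univ _)
      simpa [hi] using this
  set K : ENNReal := ∏ i ∈ Finset.univ.erase i0, volume (Metric.ball (q i) r) with hK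
  have hKtop : K ≠ ⊤ := ENNReal.prod_ne_top fun i _ => measure_ball_lt_top.ne
  have hK0 : K ≠ 0 := Finset.prod_ne_zero_iff.2 fun i _ => (Metric.measure_ball_pos _ _ hrpos).ne'
  have hvol : ∀ k, volume (A k) = ENNReal.ofReal (ρ k) ^ 2 * NNReal.pi * K := by
    intro k
    rw [hA, volume_pi_pi, ← Finset.mul_prod_erase _ _ (Finset.mem_univ i0)]
    congr 1
    · rw [if_pos rfl, measure_sdiff_null (by simp), Complex.volume_ball]
    · refine Finset.prod_congr rfl fun i hi => ?_
      rw [if_neg (Finset.ne_of_mem_erase hi)]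
  have hρlim : Filter.Tendsto ρ Filter.atTop (nhds 0) := by
    have := (tendsto_one_div_add_atTop_nhds_zero_nat (𝕜 := ℝ)).const_mul r
    simpa [div_eq_mul_inv, hρ] using this
  have hAlim : Filter.Tendsto (volume ∘ A) Filter.atTop (nhds 0) := by
    have e : volume ∘ A = fun k => ENNReal.ofReal (ρ k ^ 2) * (NNReal.pi * K) := by
      funext k
      rw [Function.comp, hvol, ENNReal.ofReal_pow (hρpos k).le, mul_assoc]
    rw [e]
    have h2 : Filter.Tendsto (fun k => ENNReal.ofReal (ρ k ^ 2)) Filter.atTop (nhds 0) := by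
      have := ENNReal.tendsto_ofReal (hρlim.pow 2)
      simpa using this
    have := ENNReal.Tendsto.mul_const h2 (b := NNReal.pi * K)
      (Or.inr (ENNReal.mul_ne_top ENNReal.coe_ne_top hKtop))
    simpa using this
  have hAmeas : ∀ k, MeasurableSet (A k) := by
    intro k
    refine MeasurableSet.univ_pi fun i => ?_
    split_ifs
    · exact measurableSet_ball.diff (measurableSet_singleton _)
    · exact measurableSet_ball
  have hAlim' : Filter.Tendsto ((volume.restrict (U ∩ {z : Fin n → ℂ | z i0 ≠ 0})) ∘ A)
      Filter.atTop (nhds 0) :=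
    tendsto_of_tendsto_of_tendsto_of_le_of_le tendsto_const_nhds hAlim (fun _ => zero_le)
      (fun k => Measure.restrict_apply_le _ _)
  have hlim := tendsto_setLIntegral_zero hint hAlim'
  have hlow : ∀ k, ENNReal.ofReal (c ^ 2) * (NNReal.pi * K) ≤
      ∫⁻ z in A k, ENNReal.ofReal (‖f z‖ ^ 2 * ‖z i0‖ ^ (-(2 * α)))
        ∂(volume.restrict (U ∩ {z : Fin n → ℂ | z i0 ≠ 0})) := by
    intro k
    have hsub : A k ⊆ U ∩ {z : Fin n → ℂ | z i0 ≠ 0} := fun z hz =>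
      ⟨(hball z (hAmem k z hz).2.2).1, (hAmem k z hz).1⟩
    rw [Measure.restrict_restrict (hAmeas k), Set.inter_eq_left.2 hsub]
    calc ENNReal.ofReal (c ^ 2) * (NNReal.pi * K)
        = ENNReal.ofReal (c ^ 2 * (ρ k ^ 2)⁻¹) * volume (A k) := by
          rw [hvol, ← ENNReal.ofReal_pow (hρpos k).le, mul_assoc,
            ← mul_assoc (ENNReal.ofReal (c ^ 2 * (ρ k ^ 2)⁻¹)),
            ← ENNReal.ofReal_mul (by positivity)]
          congr 2
          have := (hρpos k).ne'
          field_simp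
      _ = ∫⁻ z in A k, ENNReal.ofReal (c ^ 2 * (ρ k ^ 2)⁻¹) := (setLIntegral_const _ _).symm
      _ ≤ _ := by
          refine setLIntegral_mono' (hAmeas k) fun z hz => ?_
          obtain ⟨hz0, hzρ, hzb⟩ := hAmem k z hz
          have hzpos : 0 < ‖z i0‖ := norm_pos_iff.2 hz0
          refine ENNReal.ofReal_le_ofReal (mul_le_mul ?_ ?_ (by positivity) (by positivity))
          · exact pow_le_pow_left₀ hcpos.le (hball z hzb).2.le 2
          · calc (ρ k ^ 2)⁻¹ ≤ (‖z i0‖ ^ 2)⁻¹ := by gcongr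
              _ = ‖z i0‖ ^ (-2 : ℝ) := by
                rw [Real.rpow_neg hzpos.le]; norm_num
              _ ≤ _ := Real.rpow_le_rpow_of_exponent_ge hzpos
                ((hzρ.le.trans (hρr k)).trans hr1) (by linarith)
  have := ge_of_tendsto' hlim hlow
  have hpos : ENNReal.ofReal (c ^ 2) * (NNReal.pi * K) ≠ 0 := by
    refine mul_ne_zero ?_ (mul_ne_zero ?_ hK0)
    · simpa using hcpos.ne'
    · exact_mod_cast NNReal.pi_pos.ne'
  exact hpos (le_zero_iff.1 this)

lemma diffDiv {n : ℕ} {c d : (Fin n → ℂ) → ℂ} {z : Fin n → ℂ} (hc : DifferentiableAt ℂ c z)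
    (hd : DifferentiableAt ℂ d z) (hz : d z ≠ 0) : DifferentiableAt ℂ (fun z => c z / d z) z := by
  simp only [div_eq_mul_inv]
  exact hc.mul ((differentiableAt_inv hz).comp z hd)

lemma divide {n : ℕ} (i0 : Fin n) (U : Set (Fin n → ℂ)) (hU : IsOpen U)
    (f : (Fin n → ℂ) → ℂ) (hf : DifferentiableOn ℂ f U)
    (h0 : ∀ z ∈ U, z i0 = 0 → f z = 0) :
    ∃ g : (Fin n → ℂ) → ℂ, DifferentiableOn ℂ g U ∧ ∀ z ∈ U, f z = z i0 * g z := by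
  classical
  set g : (Fin n → ℂ) → ℂ := fun z =>
    if z i0 = 0 then deriv (fun w => f (Function.update z i0 w)) 0 else f z / z i0 with hg
  refine ⟨g, ?_, ?_⟩
  swap
  · intro z hz
    by_cases h : z i0 = 0
    · rw [h0 z hz h, h, zero_mul]
    · simp only [hg, if_neg h]
      field_simp
  intro q hq
  refine DifferentiableAt.differentiableWithinAt ?_
  by_cases hq0 : q i0 = 0
  swap
  · have h1 : ∀ᶠ z in nhds q, z i0 ≠ 0 := (continuous_apply i0).continuousAt.eventually_ne hq0
    have h2 : g =ᶠ[nhds q] fun z => f z / z i0 := by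
      filter_upwards [h1] with z hz
      simp only [hg, if_neg hz]
    refine DifferentiableAt.congr_of_eventuallyEq ?_ h2
    exact diffDiv (d := fun z : Fin n → ℂ => z i0)
      (hf.differentiableAt (hU.mem_nhds hq)) (differentiableAt_apply i0 q) hq0
  obtain ⟨S, hS, hSU⟩ := Metric.isOpen_iff.1 hU q hq
  set R := S / 2 with hR
  have hRpos : 0 < R := by positivity
  have hcU : Metric.closedBall q R ⊆ U :=
    (Metric.closedBall_subset_ball (by linarith)).trans hSU
  obtain ⟨M, hM⟩ := (isCompact_closedBall q R).exists_bound_of_continuousOn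
    (hf.continuousOn.mono hcU)
  have hupd : ∀ z ∈ Metric.ball q R, ∀ w : ℂ, ‖w‖ ≤ R →
      Function.update z i0 w ∈ Metric.closedBall q R := by
    intro z hz w hw
    rw [Metric.mem_closedBall, dist_pi_le_iff hRpos.le]
    intro i
    by_cases hi : i = i0
    · subst hi
      simpa [hq0] using hw
    · rw [Function.update_of_ne hi]
      exact (dist_le_pi_dist z q i).trans (Metric.mem_ball.1 hz).le
  have hupd' : ∀ z ∈ Metric.ball q R, ∀ w ∈ Metric.ball (0 : ℂ) S,
      Function.update z i0 w ∈ U := by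
    intro z hz w hw
    refine hSU ?_
    rw [Metric.mem_ball, dist_pi_lt_iff hS]
    intro i
    by_cases hi : i = i0
    · subst hi
      simpa [hq0] using hw
    · rw [Function.update_of_ne hi]
      exact ((dist_le_pi_dist z q i).trans (Metric.mem_ball.1 hz).le).trans_lt (by linarith)
  have hz0 : ∀ z ∈ Metric.ball q (R/2), ‖z i0‖ < R/2 := by
    intro z hz
    have := (dist_le_pi_dist z q i0).trans_lt (Metric.mem_ball.1 hz)
    simpa [hq0] using this
  have hsubR : Metric.ball q (R/2) ⊆ Metric.ball q R := Metric.ball_subset_ball (by linarith)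
  have hden : ∀ z ∈ Metric.ball q (R/2), ∀ t : ℝ, R/2 ≤ ‖circleMap 0 R t - z i0‖ := by
    intro z hz t
    have h1 := norm_sub_norm_le (circleMap 0 R t) (z i0)
    have h2 : ‖circleMap 0 R t‖ = R := by simp [abs_of_pos hRpos]
    have := hz0 z hz
    linarith
  have hden0 : ∀ z ∈ Metric.ball q (R/2), ∀ t : ℝ, circleMap 0 R t - z i0 ≠ 0 := fun z hz t h => by
    have := hden z hz t
    rw [h, norm_zero] at this
    linarith
  have hcm : ∀ t : ℝ, ‖circleMap 0 R t‖ ≤ R := fun t => by simp [abs_of_pos hRpos]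
  have hdU : ∀ (z) (hz : z ∈ Metric.ball q R) (w : ℂ) (hw : ‖w‖ ≤ R),
      DifferentiableAt ℂ f (Function.update z i0 w) := fun z hz w hw =>
    hf.differentiableAt (hU.mem_nhds (hcU (hupd z hz w hw)))
  have hM0 : 0 ≤ M := (norm_nonneg _).trans (hM q (Metric.mem_closedBall_self hRpos.le))
  -- the parametric integral
  have hI := paramInt (fun z t => f (Function.update z i0 (circleMap 0 R t)) /
      (circleMap 0 R t - z i0)) q (R/2) (M / (R/2)) 0 (2 * Real.pi) (by positivity) ?_ ?_ ?_
  · refine DifferentiableAt.congr_of_eventuallyEq (hI.const_mul ((2 * Real.pi : ℂ)⁻¹)) ?_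
    filter_upwards [Metric.ball_mem_nhds q (show 0 < R/2 by positivity)] with z hz
    set φ : ℂ → ℂ := fun w => f (Function.update z i0 w) with hφ
    have hφd : DifferentiableOn ℂ φ (Metric.ball 0 S) := by
      intro w hw
      have h1 : DifferentiableAt ℂ f (Function.update z i0 w) :=
        hf.differentiableAt (hU.mem_nhds (hupd' z (hsubR hz) w hw))
      exact (h1.comp w (hasFDerivAt_update z w).differentiableAt).differentiableWithinAt
    have hφ0 : φ 0 = 0 := h0 _ (hupd' z (hsubR hz) 0 (by simpa using hS)) (by simp)
    have hψd : DifferentiableOn ℂ (dslope φ 0) (Metric.ball 0 S) :=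
      (Complex.differentiableOn_dslope (Metric.ball_mem_nhds 0 hS)).2 hφd
    have hψ : DiffContOnCl ℂ (dslope φ 0) (Metric.ball 0 R) :=
      (hψd.mono (Metric.closedBall_subset_ball (by linarith))).diffContOnCl_ball subset_rfl
    have hzR : z i0 ∈ Metric.ball (0:ℂ) R := by
      have := hz0 z hz
      simp only [Metric.mem_ball, dist_zero_right]
      linarith
    have hC := hψ.circleIntegral_sub_inv_smul hzR
    have hgz : g z = dslope φ 0 (z i0) := by
      by_cases h : z i0 = 0
      · simp only [hg, if_pos h]
        rw [h, dslope_same]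
      · simp only [hg, if_neg h]
        rw [dslope_of_ne _ h, slope_def_field, hφ0]
        simp [hφ]
    have hCI : (∮ w in C(0, R), (w - z i0)⁻¹ • dslope φ 0 w) =
        Complex.I * ∫ t in (0:ℝ)..(2 * Real.pi), f (Function.update z i0 (circleMap 0 R t)) /
          (circleMap 0 R t - z i0) := by
      rw [circleIntegral, ← intervalIntegral.integral_const_mul]
      congr 1
      funext t
      have hw : circleMap 0 R t ≠ 0 := circleMap_ne_center hRpos.ne'
      have hw2 := hden0 z hz t
      rw [dslope_of_ne _ hw, slope_def_field, hφ0, deriv_circleMap]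
      simp only [smul_eq_mul, hφ, sub_zero]
      field_simp
    rw [hCI] at hC
    rw [hgz]
    have hpi : (Real.pi : ℂ) ≠ 0 := Complex.ofReal_ne_zero.2 Real.pi_ne_zero
    have hC' := mul_left_cancel₀ Complex.I_ne_zero
      (hC.trans (show _ = Complex.I * ((2 * Real.pi) * dslope φ 0 (z i0)) by
        rw [smul_eq_mul]; ring))
    rw [hC']
    field_simp
  · intro t z hz
    refine DifferentiableAt.differentiableWithinAt ?_
    refine diffDiv (d := fun z : Fin n → ℂ => circleMap 0 R t - z i0)
      ?_ ?_ (hden0 z hz t)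
    · refine DifferentiableAt.comp z (hdU z (hsubR hz) _ (hcm t)) ?_
      rw [differentiableAt_pi]
      intro i
      by_cases hi : i = i0
      · subst hi
        simp
      · simpa [Function.update_of_ne hi] using differentiableAt_apply i z
    · exact (differentiableAt_const _).sub (differentiableAt_apply i0 z)
  · intro t z hz
    rw [norm_div]
    exact div_le_div₀ hM0 (hM _ (hupd z (hsubR hz) _ (hcm t))) (by positivity) (hden z hz t)
  · intro z hz
    refine Continuous.div ?_ (by fun_prop) (hden0 z hz)
    rw [continuous_iff_continuousAt]
    intro t
    have h1 := (hdU z (hsubR hz) _ (hcm t)).continuousAt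
    have h2 : ContinuousAt (fun t => Function.update z i0 (circleMap 0 R t)) t :=
      (continuous_const.update i0 (continuous_circleMap 0 R)).continuousAt
    exact ContinuousAt.comp (g := f) h1 h2

lemma mainInd {n : ℕ} (i0 : Fin n) (U : Set (Fin n → ℂ)) (hU : IsOpen U) (k : ℕ) :
    ∀ (α : ℝ) (_ : (k : ℝ) ≤ α) (f : (Fin n → ℂ) → ℂ) (_ : DifferentiableOn ℂ f U)
    (_ : (∫⁻ z in U ∩ {z | z i0 ≠ 0},
      ENNReal.ofReal (‖f z‖ ^ 2 * ‖z i0‖ ^ (-(2 * α)))) ≠ ⊤),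
    ∃ g : (Fin n → ℂ) → ℂ, DifferentiableOn ℂ g U ∧ ∀ z ∈ U, f z = z i0 ^ k * g z := by
  induction k with
  | zero => exact fun α _ f hf _ => ⟨f, hf, fun z _ => by simp⟩
  | succ k ih =>
    intro α hα f hf hint
    push_cast at hα
    have hk : (0:ℝ) ≤ k := Nat.cast_nonneg k
    obtain ⟨g, hg, hfg⟩ := divide i0 U hU f hf fun z hz hz0 =>
      vanish i0 U hU z hz hz0 α (by linarith) f
        (hf.differentiableAt (hU.mem_nhds hz)).continuousAt hint
    obtain ⟨h, hh, hgh⟩ := ih (α - 1) (by linarith) g hg (by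
      have hm : MeasurableSet (U ∩ {z : Fin n → ℂ | z i0 ≠ 0}) :=
        (hU.inter (isOpen_ne_fun (continuous_apply i0) continuous_const)).measurableSet
      rw [← setLIntegral_congr_fun hm (f := fun z =>
        ENNReal.ofReal (‖f z‖ ^ 2 * ‖z i0‖ ^ (-(2 * α))))]
      · exact hint
      · intro z hz
        have hpos : 0 < ‖z i0‖ := norm_pos_iff.2 hz.2
        simp only
        congr 1
        rw [hfg z hz.1, norm_mul, show -(2 * (α - 1)) = -(2 * α) + (2 : ℕ) by push_cast; ring,
          Real.rpow_add_natCast hpos.ne']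
        ring)
    exact ⟨h, hh, fun z hz => by rw [hfg z hz, hgh z hz]; ring⟩

/-- Proposition 2.8 of the paper in its single-component, `n`-variable form: if `f` is
holomorphic on a connected open neighborhood `U` of a point of the hyperplane `{z_1 = 0}`
and `∫_U |f|² |z_1|^{-2α} dV < ∞` with `α ≥ 1`, then `f = z_1^{⌊α⌋} · g` for some
holomorphic `g` on `U`. -/
theorem stmt_9 {n : ℕ} (hn : 0 < n) (U : Set (Fin n → ℂ)) (hU : IsOpen U)
    (hconn : IsPreconnected U) (p : Fin n → ℂ) (hp : p ∈ U) (hp0 : p ⟨0, hn⟩ = 0)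
    (α : ℝ) (hα : 1 ≤ α) (f : (Fin n → ℂ) → ℂ) (hf : DifferentiableOn ℂ f U)
    (hint : (∫⁻ z in U, ENNReal.ofReal (‖f z‖ ^ 2 * ‖z ⟨0, hn⟩‖ ^ (-(2 * α)))) ≠ ⊤) :
    ∃ g : (Fin n → ℂ) → ℂ, DifferentiableOn ℂ g U ∧
      ∀ z ∈ U, f z = (z ⟨0, hn⟩) ^ (⌊α⌋.toNat) * g z := by
  obtain ⟨g, hg, hfg⟩ := mainInd ⟨0, hn⟩ U hU ⌊α⌋.toNat α (by
    have h1 : (0 : ℤ) ≤ ⌊α⌋ := Int.floor_nonneg.2 (by linarith)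
    have h2 : ((⌊α⌋.toNat : ℤ) : ℝ) = (⌊α⌋ : ℝ) := by rw [Int.toNat_of_nonneg h1]
    have h3 := Int.floor_le α
    rw [← h2] at h3
    exact_mod_cast h3) f hf
    (ne_top_of_le_ne_top hint (lintegral_mono_set Set.inter_subset_left))
  exact ⟨g, hg, hfg⟩
end

section
/- Let D ⊆ ℂⁿ be an open set, A ⊆ D the zero set of a single holomorphic function h on D that is not identically zero on any connected component of D, and f a holomorphic function on D \ A such that ∫_{D \ A} |f|² dV < ∞ for Lebesgue measure dV on every relatively compact open subset of D. Then f extends to a holomorphic function on all of D. -/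
open MeasureTheory

open Metric Set Filter Topology

lemma measurable_indicator_aux {E : Type*} [TopologicalSpace E] [MeasurableSpace E] [BorelSpace E]
    {s : Set E} (hs : IsOpen s) {φ : E → ENNReal} (hφ : ContinuousOn φ s) :
    Measurable (s.indicator φ) := by
  classical
  rw [← Set.piecewise_eq_indicator]
  exact hφ.measurable_piecewise continuousOn_const hs.measurableSet

/-- circle sub-mean value -/
lemma circle_submean {q : ℂ → ℂ} {c w : ℂ} {ρ : ℝ} (hq : DifferentiableOn ℂ q (ball c ρ))
    (hw : w ∈ ball (0:ℂ) ρ) :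
    ENNReal.ofReal (2 * Real.pi) * ‖q c‖ₑ ≤
      ∫⁻ θ in Ioc 0 (2 * Real.pi), ‖q (c + Complex.exp (θ * Complex.I) * w)‖ₑ := by
  have hw' : ‖w‖ < ρ := by simpa using hw
  have h1 : Real.circleAverage q c ‖w‖ = q c := by
    apply DiffContOnCl.circleAverage
    apply DifferentiableOn.diffContOnCl
    apply hq.mono
    refine closure_ball_subset_closedBall.trans ?_
    apply closedBall_subset_ball
    simpa using hw'
  rw [Real.circleAverage_eq_integral_add (Complex.arg w)] at h1
  have h2 : (∫ θ in (0:ℝ)..2 * Real.pi, q (c + Complex.exp (θ * Complex.I) * w))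
      = (2 * Real.pi) • q c := by
    rw [← h1, smul_smul, mul_inv_cancel₀ (by positivity), one_smul]
    congr 1
    ext θ
    congr 1
    rw [circleMap]
    congr 1
    conv_lhs => rw [← Complex.norm_mul_exp_arg_mul_I w]
    push_cast
    rw [add_mul, Complex.exp_add]
    ring
  have h3 := enorm_integral_le_lintegral_enorm (μ := volume.restrict (Ioc 0 (2 * Real.pi)))
    (fun θ : ℝ => q (c + Complex.exp (θ * Complex.I) * w))
  rw [intervalIntegral.integral_of_le (by positivity)] at h2
  rw [h2, enorm_smul, Real.enorm_of_nonneg (by positivity)] at h3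
  exact h3

lemma area_submean {q : ℂ → ℂ} {c : ℂ} {ρ : ℝ} (hq : DifferentiableOn ℂ q (ball c ρ)) :
    volume (ball c ρ) * ‖q c‖ₑ ≤ ∫⁻ z in ball c ρ, ‖q z‖ₑ := by
  set ψ : ℂ → ENNReal := (ball c ρ).indicator (fun z => ‖q z‖ₑ) with hψ
  have hψm : Measurable ψ := measurable_indicator_aux isOpen_ball hq.continuousOn.enorm
  have e1 : ∫⁻ z in ball c ρ, ‖q z‖ₑ = ∫⁻ w, ψ (c + w) := by
    rw [lintegral_add_left_eq_self, hψ, lintegral_indicator measurableSet_ball]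
  have e2 : ∀ θ : ℝ, ∫⁻ w, ψ (c + Complex.exp (θ * Complex.I) * w) = ∫⁻ w, ψ (c + w) := by
    intro θ
    have := (rotation (Circle.exp θ)).measurePreserving.lintegral_comp
      (f := fun w => ψ (c + w)) (hψm.comp (measurable_const_add c))
    rw [← this]
    simp [rotation_apply]
  have hpos : ENNReal.ofReal (2 * Real.pi) ≠ 0 := by simp [Real.pi_pos]
  have e3 : ENNReal.ofReal (2 * Real.pi) * (volume (ball c ρ) * ‖q c‖ₑ) ≤
      ENNReal.ofReal (2 * Real.pi) * ∫⁻ w, ψ (c + w) := by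
    calc ENNReal.ofReal (2 * Real.pi) * (volume (ball c ρ) * ‖q c‖ₑ)
        = ∫⁻ w in ball (0:ℂ) ρ, ENNReal.ofReal (2 * Real.pi) * ‖q c‖ₑ := by
          rw [setLIntegral_const, Complex.volume_ball, Complex.volume_ball]; ring
      _ ≤ ∫⁻ w in ball (0:ℂ) ρ, ∫⁻ θ in Ioc 0 (2 * Real.pi),
            ψ (c + Complex.exp (θ * Complex.I) * w) := by
          apply setLIntegral_mono' measurableSet_ball
          intro w hw
          refine (circle_submean hq hw).trans (le_of_eq ?_)
          apply lintegral_congr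
          intro θ
          rw [hψ, indicator_of_mem]
          simpa [Complex.norm_exp_ofReal_mul_I] using hw
      _ ≤ ∫⁻ w, ∫⁻ θ in Ioc 0 (2 * Real.pi),
            ψ (c + Complex.exp (θ * Complex.I) * w) := setLIntegral_le_lintegral _ _
      _ = ∫⁻ (θ : ℝ) in Ioc 0 (2 * Real.pi), ∫⁻ w, ψ (c + Complex.exp (θ * Complex.I) * w) := by
          apply lintegral_lintegral_swap
          apply Measurable.aemeasurable
          apply hψm.comp
          fun_prop
      _ = _ := by
          simp_rw [e2]
          rw [setLIntegral_const, Real.volume_Ioc, sub_zero, mul_comm]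
  rw [e1]
  exact (ENNReal.mul_le_mul_iff_right hpos ENNReal.ofReal_ne_top).1 e3

lemma littleO_of_L2 {g : ℂ → ℂ} {c : ℂ} {ρ : ℝ} (hρ : 0 < ρ)
    (hg : DifferentiableOn ℂ g (ball c ρ \ {c}))
    (hint : ∫⁻ z in ball c ρ, ‖g z‖ₑ ^ 2 ≠ ⊤) :
    (fun z => g z - g c) =o[𝓝[≠] c] fun z => (z - c)⁻¹ := by
  have hc : (fun _ : ℂ => g c) =o[𝓝[≠] c] fun z => (z - c)⁻¹ := by
    apply Asymptotics.isLittleO_const_left.2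
    right
    have : Tendsto (fun z => z - c) (𝓝[≠] c) (𝓝[≠] 0) := by
      apply tendsto_nhdsWithin_of_tendsto_nhds_of_eventually_within
      · have : Tendsto (fun z => z - c) (𝓝 c) (𝓝 (c - c)) := by
          exact (continuous_id.sub continuous_const).tendsto c
        rw [sub_self] at this
        exact this.mono_left nhdsWithin_le_nhds
      · filter_upwards [self_mem_nhdsWithin] with z hz
        exact sub_ne_zero.2 hz
    exact tendsto_norm_cobounded_atTop.comp (tendsto_inv₀_nhdsNE_zero.comp this)
  refine Asymptotics.IsLittleO.sub ?_ hc
  have key : ∀ z, z ≠ c → 2 * dist z c < ρ →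
      ENNReal.ofReal (dist z c ^ 2) * ‖g z‖ₑ ^ 2 ≤
        ∫⁻ x in ball c (2 * dist z c), ‖g x‖ₑ ^ 2 ∂(volume.restrict (ball c ρ)) := by
    intro z hz hd
    have hd0 : 0 < dist z c := dist_pos.2 hz
    have hsub : ball z (dist z c) ⊆ ball c (2 * dist z c) := by
      apply ball_subset_ball'
      linarith
    have hsub2 : ball c (2 * dist z c) ⊆ ball c ρ := ball_subset_ball hd.le
    have h1 : DifferentiableOn ℂ (fun x => g x ^ 2) (ball z (dist z c)) := by
      apply (hg.mono _).pow
      intro x hx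
      refine ⟨hsub2 (hsub hx), ?_⟩
      rintro rfl
      simp [dist_comm] at hx
    have h2 := area_submean h1
    rw [Measure.restrict_restrict measurableSet_ball, inter_eq_left.2 hsub2]
    simp only [enorm_pow] at h2
    refine le_trans ?_ (h2.trans (lintegral_mono_set hsub))
    gcongr
    rw [Complex.volume_ball, ENNReal.ofReal_pow hd0.le]
    refine le_mul_of_one_le_right (by simp) ?_
    exact_mod_cast (show (1:ℝ) ≤ (NNReal.pi : ℝ) by simpa using (by linarith [Real.pi_gt_three]))
  have lim : Tendsto (fun z => ∫⁻ x in ball c (2 * dist z c), ‖g x‖ₑ ^ 2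
      ∂(volume.restrict (ball c ρ))) (𝓝 c) (𝓝 0) := by
    apply tendsto_setLIntegral_zero hint
    apply tendsto_of_tendsto_of_tendsto_of_le_of_le tendsto_const_nhds (h := fun z =>
      volume (ball c (2 * dist z c))) _ (fun _ => zero_le) (fun z => Measure.restrict_apply_le _ _)
    simp only [Complex.volume_ball]
    have : Continuous fun z : ℂ => ENNReal.ofReal (2 * dist z c) ^ 2 * (NNReal.pi : ENNReal) := by
      refine (ENNReal.continuous_mul_const (by simp)).comp ?_
      exact (ENNReal.continuous_pow 2).comp (ENNReal.continuous_ofReal.comp (by fun_prop))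
    have := this.tendsto c
    simpa using this
  rw [Asymptotics.isLittleO_iff]
  intro ε hε
  have ev1 := lim.eventually (gt_mem_nhds (show (0:ENNReal) < ENNReal.ofReal (ε ^ 2) by
    simpa using by positivity))
  have ev2 : ∀ᶠ z in 𝓝 c, 2 * dist z c < ρ := by
    have : Continuous fun z : ℂ => 2 * dist z c := by fun_prop
    apply this.tendsto c |>.eventually (gt_mem_nhds _)
    simpa using hρ
  filter_upwards [nhdsWithin_le_nhds ev1, nhdsWithin_le_nhds ev2, self_mem_nhdsWithin] with z h1 h2 h3
  have h4 := (key z h3 h2).trans h1.le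
  have hd0 : 0 < dist z c := dist_pos.2 h3
  rw [← ofReal_norm, ← ENNReal.ofReal_pow (norm_nonneg _), ← ENNReal.ofReal_mul (by positivity),
    ENNReal.ofReal_le_ofReal_iff (by positivity), ← mul_pow] at h4
  have h5 := (pow_le_pow_iff_left₀ (by positivity) hε.le two_ne_zero).1 h4
  rw [norm_inv, ← dist_eq_norm, ← div_eq_mul_inv, le_div_iff₀ hd0]
  linarith

lemma mean_of_L2 {g k : ℂ → ℂ} {r R : ℝ} (hr : 0 < r) (hrR : r < R)
    (hk : DifferentiableOn ℂ k (ball 0 R)) (hk0 : k 0 ≠ 0)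
    (hkr : ∀ ζ ∈ sphere (0:ℂ) r, k ζ ≠ 0)
    (hg : DifferentiableOn ℂ g (ball 0 R \ {z | k z = 0}))
    (hint : ∫⁻ z in ball 0 R \ {z | k z = 0}, ‖g z‖ₑ ^ 2 ≠ ⊤) :
    Real.circleAverage g 0 r = g 0 := by
  classical
  have hka : AnalyticOnNhd ℂ k (ball 0 R) := hk.analyticOnNhd isOpen_ball
  have hR : 0 < R := hr.trans hrR
  have iso : ∀ c ∈ ball (0:ℂ) R, ∀ᶠ z in 𝓝[≠] c, k z ≠ 0 := by
    intro c hc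
    by_contra hcon
    have hfr : ∃ᶠ z in 𝓝[≠] c, k z = 0 := by
      intro h
      exact hcon h
    exact hk0 (hka.eqOn_zero_of_preconnected_of_frequently_eq_zero
      (convex_ball _ _).isPreconnected hc hfr (mem_ball_self hR))
  have hopen : IsOpen (ball (0:ℂ) R \ {z | k z = 0}) := by
    have := hk.continuousOn.isOpen_inter_preimage isOpen_ball (isOpen_compl_singleton (x := (0:ℂ)))
    have e : ball (0:ℂ) R \ {z | k z = 0} = ball (0:ℂ) R ∩ k ⁻¹' {0}ᶜ := by
      ext z; simp
    rw [e]; exact this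
  let G : ℂ → ℂ := fun z => if k z = 0 then limUnder (𝓝[≠] z) g else g z
  have hG : DifferentiableOn ℂ G (ball 0 R) := by
    intro c hc
    apply DifferentiableAt.differentiableWithinAt
    by_cases hkc : k c = 0
    · obtain ⟨ρ, hρ, hρs⟩ : ∃ ρ > 0, ball c ρ \ {c} ⊆ ball (0:ℂ) R \ {z | k z = 0} := by
        have := (iso c hc).and (nhdsWithin_le_nhds (isOpen_ball.mem_nhds hc))
        rw [eventually_nhdsWithin_iff, Metric.eventually_nhds_iff_ball] at this
        obtain ⟨ρ, hρ, H⟩ := this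
        exact ⟨ρ, hρ, fun z hz => ⟨(H z hz.1 hz.2).2, (H z hz.1 hz.2).1⟩⟩
      have hgd := hg.mono hρs
      have hi : ∫⁻ z in ball c ρ, ‖g z‖ₑ ^ 2 ≠ ⊤ := by
        refine ne_top_of_le_ne_top hint ?_
        rw [← setLIntegral_congr (sdiff_null_ae_eq_self (s := ball c ρ) (measure_singleton c))]
        exact lintegral_mono_set hρs
      have h1 := Complex.differentiableOn_update_limUnder_of_isLittleO (ball_mem_nhds c hρ) hgd
        (littleO_of_L2 hρ hgd hi)
      refine (h1.differentiableAt (ball_mem_nhds c hρ)).congr_of_eventuallyEq ?_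
      filter_upwards [ball_mem_nhds c hρ] with z hz
      by_cases hzc : z = c
      · subst hzc; simp [G, hkc]
      · have : k z ≠ 0 := (hρs ⟨hz, hzc⟩).2
        simp [G, this, hzc]
    · have hmem := hopen.mem_nhds (show c ∈ _ from ⟨hc, hkc⟩)
      refine (hg.differentiableAt hmem).congr_of_eventuallyEq ?_
      filter_upwards [hmem] with z hz
      have : k z ≠ 0 := hz.2
      simp [G, this]
  have h1 : Real.circleAverage G 0 r = G 0 := by
    apply DiffContOnCl.circleAverage
    apply DifferentiableOn.diffContOnCl
    apply hG.mono
    refine closure_ball_subset_closedBall.trans (closedBall_subset_ball ?_)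
    rwa [abs_of_pos hr]
  have h2 : G 0 = g 0 := by simp [G, hk0]
  rw [← h2, ← h1]
  apply Real.circleAverage_congr_sphere
  intro ζ hζ
  rw [abs_of_pos hr] at hζ
  simp [G, hkr ζ hζ]

lemma param_diff {n : ℕ} {Ω : Set (Fin n → ℂ)} (hΩ : IsOpen Ω) {f : (Fin n → ℂ) → ℂ}
    (hf : DifferentiableOn ℂ f Ω) {v a : Fin n → ℂ} {r : ℝ}
    (ha : ∀ ζ ∈ sphere (0:ℂ) |r|, a + ζ • v ∈ Ω) :
    DifferentiableAt ℂ (fun z => Real.circleAverage (fun ζ => f (z + ζ • v)) 0 r) a := by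
  set C : Set (Fin n → ℂ) := (fun ζ : ℂ => a + ζ • v) '' sphere (0:ℂ) |r| with hC
  have hCc : IsCompact C := (isCompact_sphere _ _).image (by fun_prop)
  have hCΩ : C ⊆ Ω := by
    rintro _ ⟨ζ, hζ, rfl⟩
    exact ha ζ hζ
  obtain ⟨δ, hδ, hδΩ⟩ := hCc.exists_cthickening_subset_open hΩ hCΩ
  have hTc : IsCompact (cthickening δ C) := hCc.cthickening
  obtain ⟨M, hM⟩ := hTc.exists_bound_of_continuousOn (hf.continuousOn.mono hδΩ)
  have hmemC : ∀ θ, a + circleMap 0 r θ • v ∈ C := fun θ =>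
    ⟨circleMap 0 r θ, circleMap_mem_sphere' 0 r θ, rfl⟩
  have hball : ∀ θ, ball (a + circleMap 0 r θ • v) δ ⊆ cthickening δ C := fun θ x hx =>
    mem_cthickening_of_dist_le x _ δ C (hmemC θ) (mem_ball.1 hx).le
  have hmemx : ∀ x ∈ ball a δ, ∀ θ, x + circleMap 0 r θ • v ∈ ball (a + circleMap 0 r θ • v) δ := by
    intro x hx θ
    simpa using hx
  have hcont : ∀ x ∈ ball a δ, Continuous fun θ => f (x + circleMap 0 r θ • v) := by
    intro x hx
    apply (hf.continuousOn).comp_continuous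
    · fun_prop
    · intro θ
      exact hδΩ (hball θ (hmemx x hx θ))
  have hfd : ∀ θ, DifferentiableAt ℂ f (a + circleMap 0 r θ • v) := fun θ =>
    hf.differentiableAt (hΩ.mem_nhds (hCΩ (hmemC θ)))
  have hmeas : AEStronglyMeasurable (fun θ => fderiv ℂ f (a + circleMap 0 r θ • v))
      (volume.restrict (Ioc 0 (2 * Real.pi))) := by
    apply Measurable.aestronglyMeasurable
    apply (measurable_fderiv ℂ f).comp
    fun_prop
  have main := hasFDerivAt_integral_of_dominated_loc_of_lip' (𝕜 := ℂ)
    (μ := volume.restrict (Ioc 0 (2 * Real.pi)))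
    (F := fun x θ => f (x + circleMap 0 r θ • v)) (x₀ := a) (bound := fun _ => (2 * M) / δ)
    (F' := fun θ => fderiv ℂ f (a + circleMap 0 r θ • v)) (ball_mem_nhds a hδ)
    (fun x hx => (hcont x hx).aestronglyMeasurable)
    ((hcont a (mem_ball_self hδ)).integrableOn_Ioc)
    hmeas
    (Eventually.of_forall fun θ x hx => by
      have := Complex.dist_le_div_mul_dist_of_mapsTo_ball (hf.mono ((hball θ).trans hδΩ))
        (R₂ := 2 * M) (fun y hy => by
          rw [mem_closedBall, dist_eq_norm]
          refine (norm_sub_le _ _).trans ?_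
          have := hM y (hball θ hy)
          have := hM _ (hball θ (mem_ball_self hδ))
          linarith) (hmemx x hx θ)
      simpa [dist_eq_norm] using this)
    (integrable_const _)
    (Eventually.of_forall fun θ => by
      have := (hfd θ).hasFDerivAt
      have h2 : HasFDerivAt (fun x : Fin n → ℂ => x + circleMap 0 r θ • v)
        (ContinuousLinearMap.id ℂ _) a := (hasFDerivAt_id a).add_const _
      have h3 := HasFDerivAt.comp a this h2
      rw [ContinuousLinearMap.comp_id] at h3
      exact h3)
  simp only [Real.circleAverage, intervalIntegral.integral_of_le Real.two_pi_pos.le]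
  exact main.2.differentiableAt.const_smul _

lemma ae_slice {n : ℕ} {Φ : (Fin n → ℂ) → ENNReal} (hΦ : Measurable Φ)
    (hint : ∫⁻ z, Φ z ≠ ⊤) (v : Fin n → ℂ) (R : ℝ) :
    ∀ᵐ z, ∫⁻ ζ in ball (0:ℂ) R, Φ (z + ζ • v) ≠ ⊤ := by
  have hm : Measurable (Function.uncurry fun (z : Fin n → ℂ) (ζ : ℂ) => Φ (z + ζ • v)) := by
    apply hΦ.comp
    fun_prop
  have hI : ∫⁻ z, ∫⁻ ζ in ball (0:ℂ) R, Φ (z + ζ • v) ≠ ⊤ := by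
    rw [lintegral_lintegral_swap hm.aemeasurable]
    simp_rw [lintegral_add_right_eq_self]
    rw [setLIntegral_const]
    exact ENNReal.mul_ne_top hint (measure_ball_lt_top).ne
  filter_upwards [ae_lt_top hm.lintegral_prod_right' hI] with z hz using hz.ne

lemma line_zero {n : ℕ} {h : (Fin n → ℂ) → ℂ} {x y w : Fin n → ℂ} {δ : ℝ}
    (hh : DifferentiableOn ℂ h (ball x δ)) (hy : y ∈ ball x δ) (hw : w ∈ ball x δ)
    (hz : h =ᶠ[𝓝 y] 0) : h w = 0 := by
  set L : ℂ → (Fin n → ℂ) := fun ζ => y + ζ • (w - y) with hL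
  have hLd : Differentiable ℂ L := by
    rw [hL]; fun_prop
  set S := L ⁻¹' ball x δ
  have hSo : IsOpen S := isOpen_ball.preimage hLd.continuous
  have hSc : Convex ℝ S := by
    intro p hp q hq s t hs ht hst
    have := (convex_ball x δ) hp hq hs ht hst
    show L _ ∈ ball x δ
    convert this using 1
    simp only [hL]
    have hst' : (s:ℂ) + t = 1 := by exact_mod_cast hst
    ext i
    simp only [Pi.add_apply, Pi.smul_apply, smul_eq_mul, Complex.real_smul]
    linear_combination (-(y i)) * hst'
  have ha : AnalyticOnNhd ℂ (h ∘ L) S :=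
    (hh.comp hLd.differentiableOn (fun _ h => h)).analyticOnNhd hSo
  have h0 : (0:ℂ) ∈ S := by simpa [S, hL] using hy
  have h1 : (1:ℂ) ∈ S := by simpa [S, hL] using hw
  have hev : (h ∘ L) =ᶠ[𝓝 0] 0 := by
    have : Tendsto L (𝓝 0) (𝓝 y) := by
      have := hLd.continuous.tendsto 0
      simpa [hL] using this
    exact this.eventually hz
  have := ha.eqOn_zero_of_preconnected_of_eventuallyEq_zero hSc.isPreconnected h0 hev h1
  simpa [hL] using this

lemma not_locally_zero {n : ℕ} {D : Set (Fin n → ℂ)} (hD : IsOpen D)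
    {h : (Fin n → ℂ) → ℂ} (hh : DifferentiableOn ℂ h D)
    (hnz : ∀ x ∈ D, ∃ y ∈ connectedComponentIn D x, h y ≠ 0) {a : Fin n → ℂ} (ha : a ∈ D) :
    ¬ h =ᶠ[𝓝 a] 0 := by
  intro hz
  set u : Set (Fin n → ℂ) := {x | h =ᶠ[𝓝 x] 0}
  have hu : IsOpen u := isOpen_setOfPred_eventually_nhds
  have hsub : connectedComponentIn D a ⊆ u := by
    apply isPreconnected_connectedComponentIn.subset_of_closure_inter_subset hu
    · exact ⟨a, mem_connectedComponentIn ha, hz⟩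
    · rintro x ⟨hxu, hxC⟩
      have hxD : x ∈ D := connectedComponentIn_subset D a hxC
      obtain ⟨δ, hδ, hb⟩ := Metric.isOpen_iff.1 hD x hxD
      obtain ⟨y, hyu, hyb⟩ := Metric.mem_closure_iff.1 hxu δ hδ
      show h =ᶠ[𝓝 x] 0
      filter_upwards [ball_mem_nhds x hδ] with w hw
      exact line_zero (hh.mono hb) (by rwa [mem_ball, dist_comm]) hw hyu
  obtain ⟨y, hy, hne⟩ := hnz a ha
  exact hne (hsub hy).self_of_nhds

lemma local_ext {n : ℕ} {D : Set (Fin n → ℂ)} (hD : IsOpen D)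
    {h : (Fin n → ℂ) → ℂ} (hh : DifferentiableOn ℂ h D)
    {f : (Fin n → ℂ) → ℂ} (hf : DifferentiableOn ℂ f (D \ {z | h z = 0}))
    (hO : IsOpen (D \ {z | h z = 0}))
    (hint : ∀ K : Set (Fin n → ℂ), IsOpen K → IsCompact (closure K) → closure K ⊆ D →
      (∫⁻ z in K \ {z | h z = 0}, ENNReal.ofReal (‖f z‖ ^ 2)) ≠ ⊤)
    {a : Fin n → ℂ} (ha : a ∈ D) (hnl : ¬ h =ᶠ[𝓝 a] 0) :
    ∃ U ∈ 𝓝 a, IsOpen U ∧ U ⊆ D ∧ ∃ F : (Fin n → ℂ) → ℂ, DifferentiableOn ℂ F U ∧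
      ∀ z ∈ U \ {z | h z = 0}, F z = f z := by
  obtain ⟨δ, hδ, hb⟩ := Metric.isOpen_iff.1 hD a ha
  -- a direction along which `h` does not vanish identically
  obtain ⟨w, hw, hhw⟩ : ∃ w ∈ ball a (δ / 4), h w ≠ 0 := by
    by_contra hcon
    push Not at hcon
    exact hnl (eventually_of_mem (ball_mem_nhds a (by positivity)) hcon)
  set v := w - a with hv
  have hvn : ‖v‖ < δ / 4 := by rwa [mem_ball, dist_eq_norm] at hw
  have hK : ∀ z ∈ ball a (δ / 4), ∀ ζ ∈ ball (0:ℂ) 2, z + ζ • v ∈ ball a (3 * δ / 4) := by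
    intro z hz ζ hζ
    rw [mem_ball, dist_eq_norm] at *
    have h1 : z + ζ • v - a = (z - a) + ζ • v := by abel
    rw [h1]
    refine (norm_add_le _ _).trans_lt ?_
    rw [norm_smul]
    rw [sub_zero] at hζ
    have : ‖ζ‖ * ‖v‖ ≤ 2 * (δ / 4) := by gcongr
    linarith
  have hKD : ball a (3 * δ / 4) ⊆ D := (ball_subset_ball (by linarith)).trans hb
  have hslice : ∀ z ∈ ball a (δ / 4), DifferentiableOn ℂ (fun ζ : ℂ => h (z + ζ • v)) (ball 0 2) := by
    intro z hz
    apply hh.comp (t := D) (f := fun ζ : ℂ => z + ζ • v) (by fun_prop)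
    intro ζ hζ
    exact hKD (hK z hz ζ hζ)
  have haa : a ∈ ball a (δ / 4) := mem_ball_self (by positivity)
  -- a radius with no zeros on the circle
  obtain ⟨r, hr, hr2, hrz⟩ : ∃ r : ℝ, 0 < r ∧ r < 2 ∧ ∀ ζ ∈ sphere (0:ℂ) r, h (a + ζ • v) ≠ 0 := by
    have han := (hslice a haa).analyticOnNhd isOpen_ball
    have hev : ∀ᶠ ζ in 𝓝[≠] (0:ℂ), h (a + ζ • v) ≠ 0 := by
      by_contra hcon
      have hfr : ∃ᶠ ζ in 𝓝[≠] (0:ℂ), h (a + ζ • v) = 0 := by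
        intro h
        exact hcon h
      have := han.eqOn_zero_of_preconnected_of_frequently_eq_zero
        (convex_ball _ _).isPreconnected (mem_ball_self two_pos) hfr
        (show (1:ℂ) ∈ ball 0 2 by simp)
      apply hhw
      simpa [hv] using this
    rw [eventually_nhdsWithin_iff, Metric.eventually_nhds_iff_ball] at hev
    obtain ⟨ρ, hρ, H⟩ := hev
    refine ⟨min (ρ / 2) 1, by positivity, (min_le_right _ _).trans_lt (by norm_num), ?_⟩
    intro ζ hζ
    have hpos : 0 < min (ρ / 2) 1 := by positivity
    have hn : ‖ζ‖ = min (ρ / 2) 1 := by simpa using hζ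
    apply H
    · rw [mem_ball, dist_zero_right, hn]
      exact (min_le_left _ _).trans_lt (by linarith)
    · intro h0
      rw [mem_singleton_iff] at h0
      rw [h0, norm_zero] at hn
      exact hpos.ne hn
  -- tube lemma
  obtain ⟨W, hWo, haW, hW⟩ : ∃ W, IsOpen W ∧ a ∈ W ∧
      ∀ z ∈ W, ∀ ζ ∈ sphere (0:ℂ) r, z + ζ • v ∈ D \ {z | h z = 0} := by
    have hNo : IsOpen ((fun p : (Fin n → ℂ) × ℂ => p.1 + p.2 • v) ⁻¹' (D \ {z | h z = 0})) :=
      hO.preimage (by fun_prop)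
    obtain ⟨W, V, hWo, hVo, haW, hSV, hWV⟩ := generalized_tube_lemma (isCompact_singleton (x := a))
      (isCompact_sphere (0:ℂ) r) hNo (by
        rintro ⟨z, ζ⟩ ⟨hz, hζ⟩
        rw [mem_singleton_iff] at hz
        simp only at hz hζ
        subst hz
        refine ⟨hKD (hK _ haa ζ ?_), hrz ζ hζ⟩
        rw [mem_sphere] at hζ
        rw [mem_ball, hζ]
        exact hr2)
    exact ⟨W, hWo, haW rfl, fun z hz ζ hζ => hWV (show (z, ζ) ∈ W ×ˢ V from ⟨hz, hSV hζ⟩)⟩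
  set U := W ∩ ball a (δ / 4) with hU
  have hUo : IsOpen U := hWo.inter isOpen_ball
  have hUD : U ⊆ D := fun z hz => hb (ball_subset_ball (by linarith) hz.2)
  set F : (Fin n → ℂ) → ℂ := fun z => Real.circleAverage (fun ζ => f (z + ζ • v)) 0 r with hF
  have hFd : DifferentiableOn ℂ F U := by
    intro z hz
    apply DifferentiableAt.differentiableWithinAt
    apply param_diff hO hf
    rw [abs_of_pos hr]
    exact hW z hz.1
  refine ⟨U, hUo.mem_nhds ⟨haW, haa⟩, hUo, hUD, F, hFd, ?_⟩
  have hUA : U \ {z | h z = 0} = U ∩ (D \ {z | h z = 0}) := by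
    ext z
    constructor
    · rintro ⟨h1, h2⟩
      exact ⟨h1, hUD h1, h2⟩
    · rintro ⟨h1, _, h2⟩
      exact ⟨h1, h2⟩
  have hUAo : IsOpen (U \ {z | h z = 0}) := by
    rw [hUA]; exact hUo.inter hO
  -- integrability
  set K := ball a (3 * δ / 4) with hKdef
  have hKA : K \ {z | h z = 0} = K ∩ (D \ {z | h z = 0}) := by
    ext z
    constructor
    · rintro ⟨h1, h2⟩
      exact ⟨h1, hKD h1, h2⟩
    · rintro ⟨h1, _, h2⟩
      exact ⟨h1, h2⟩
  have hKAo : IsOpen (K \ {z | h z = 0}) := by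
    rw [hKA]; exact isOpen_ball.inter hO
  have hKcl : closure K ⊆ closedBall a (3 * δ / 4) := closure_ball_subset_closedBall
  have hKi := hint K isOpen_ball
    ((isCompact_closedBall a (3 * δ / 4)).of_isClosed_subset isClosed_closure hKcl)
    (hKcl.trans ((closedBall_subset_ball (by linarith)).trans hb))
  have henorm : ∀ z, ENNReal.ofReal (‖f z‖ ^ 2) = ‖f z‖ₑ ^ 2 := by
    intro z
    rw [ENNReal.ofReal_pow (norm_nonneg _), ofReal_norm]
  simp_rw [henorm] at hKi
  have hfK : DifferentiableOn ℂ f (K \ {z | h z = 0}) := hf.mono (by rw [hKA]; exact inter_subset_right)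
  set Φ : (Fin n → ℂ) → ENNReal := (K \ {z | h z = 0}).indicator (fun z => ‖f z‖ₑ ^ 2) with hΦ
  have hΦm : Measurable Φ := measurable_indicator_aux hKAo
    ((ENNReal.continuous_pow 2).comp_continuousOn hfK.continuousOn.enorm)
  have hΦi : ∫⁻ z, Φ z ≠ ⊤ := by
    rw [hΦ, lintegral_indicator hKAo.measurableSet]
    exact hKi
  have hae := ae_slice hΦm hΦi v 2
  have heq : F =ᵐ[volume.restrict (U \ {z | h z = 0})] f := by
    rw [Filter.EventuallyEq, ae_restrict_iff' hUAo.measurableSet]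
    filter_upwards [hae] with z hz hzU
    have hzb : z ∈ ball a (δ / 4) := hzU.1.2
    have hmaps : MapsTo (fun ζ : ℂ => z + ζ • v) (ball (0:ℂ) 2 \ {ζ | h (z + ζ • v) = 0})
        (K \ {z | h z = 0}) := fun ζ hζ => ⟨hK z hzb ζ hζ.1, hζ.2⟩
    have := mean_of_L2 (g := fun ζ => f (z + ζ • v)) (k := fun ζ => h (z + ζ • v)) hr hr2
      (hslice z hzb) (by simpa using hzU.2) (fun ζ hζ => (hW z hzU.1.1 ζ hζ).2)
      (hfK.comp (by fun_prop) hmaps) (by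
        refine ne_top_of_le_ne_top hz ?_
        refine le_trans ?_ (lintegral_mono_set (sdiff_subset (t := {ζ | h (z + ζ • v) = 0})))
        apply setLIntegral_mono (hΦm.comp (by fun_prop))
        intro ζ hζ
        have e : Φ (z + ζ • v) = ‖f (z + ζ • v)‖ₑ ^ 2 := indicator_of_mem (hmaps hζ) _
        exact e.ge)
    simpa [hF] using this
  exact Measure.eqOn_open_of_ae_eq heq hUAo (hFd.continuousOn.mono sdiff_subset)
    (hf.continuousOn.mono (by rw [hUA]; exact inter_subset_right))

/-- L² Riemann extension theorem: let `A ⊆ D` be the zero set of a holomorphic function `h`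
on an open `D ⊆ ℂⁿ` which is not identically zero on any connected component of `D`, and let
`f` be holomorphic on `D \ A` with `∫ |f|² dV < ∞` over (the part in `D \ A` of) every
relatively compact open subset of `D`. Then `f` extends holomorphically to `D`. -/
theorem stmt_19 {n : ℕ} (D : Set (Fin n → ℂ)) (hD : IsOpen D)
    (h : (Fin n → ℂ) → ℂ) (hh : DifferentiableOn ℂ h D)
    (hnz : ∀ x ∈ D, ∃ y ∈ connectedComponentIn D x, h y ≠ 0)
    (f : (Fin n → ℂ) → ℂ) (hf : DifferentiableOn ℂ f (D \ {z | h z = 0}))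
    (hint : ∀ K : Set (Fin n → ℂ), IsOpen K → IsCompact (closure K) → closure K ⊆ D →
      (∫⁻ z in K \ {z | h z = 0}, ENNReal.ofReal (‖f z‖ ^ 2)) ≠ ⊤) :
    ∃ F : (Fin n → ℂ) → ℂ, DifferentiableOn ℂ F D ∧
      ∀ z ∈ D \ {z | h z = 0}, F z = f z := by
  have hO : IsOpen (D \ {z | h z = 0}) := by
    have := hh.continuousOn.isOpen_inter_preimage hD (isOpen_compl_singleton (x := (0:ℂ)))
    have e : D \ {z | h z = 0} = D ∩ h ⁻¹' {0}ᶜ := by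
      ext z; simp
    rw [e]; exact this
  have hnl : ∀ a ∈ D, ¬ h =ᶠ[𝓝 a] 0 := fun a ha => not_locally_zero hD hh hnz ha
  have hne : ∀ a ∈ D, (𝓝[D \ {z | h z = 0}] a).NeBot := by
    intro a ha
    rw [← mem_closure_iff_nhdsWithin_neBot, mem_closure_iff_nhds]
    intro t ht
    by_contra hcon
    apply hnl a ha
    filter_upwards [ht, hD.mem_nhds ha] with z hz hzD
    by_contra hz0
    exact hcon ⟨z, hz, hzD, hz0⟩
  refine ⟨fun z => limUnder (𝓝[D \ {z | h z = 0}] z) f, ?_, ?_⟩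
  · intro a ha
    apply DifferentiableAt.differentiableWithinAt
    obtain ⟨U, hUa, hUo, hUD, F, hFd, hFf⟩ := local_ext hD hh hf hO hint ha (hnl a ha)
    refine (hFd.differentiableAt hUa).congr_of_eventuallyEq ?_
    filter_upwards [hUa] with z hz
    have hzn := hne z (hUD hz)
    apply Tendsto.limUnder_eq
    have hc : Tendsto F (𝓝[D \ {z | h z = 0}] z) (𝓝 (F z)) :=
      ((hFd.continuousOn.continuousAt (hUo.mem_nhds hz)).tendsto).mono_left nhdsWithin_le_nhds
    refine hc.congr' ?_
    filter_upwards [self_mem_nhdsWithin, nhdsWithin_le_nhds (hUo.mem_nhds hz)] with x hx hxU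
    exact hFf x ⟨hxU, hx.2⟩
  · intro z hz
    have hzn := hne z hz.1
    apply Tendsto.limUnder_eq
    exact (hf.continuousOn z hz).tendsto
end
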